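/- Let r ∈ (0,1), p ≥ 0, q ≥ 0 with p + q ≤ 1 and p + q > 0, let δ > 0, and suppose the homophily parameters are neutral: h_R = h_B = 1/2. Then all denominators in the definition of the DMPA limit map F are strictly positive on [0,1]², the point (r, r) is a fixed point of F, i.e. F(r, r) = (r, r), and the asymptotic power-disparity at this fixed point, θ*_out (1 − θ*_in) / (θ*_in (1 − θ*_out)) evaluated at θ* = (r, r), equals 1. -/

import Mathlib

open Set Filter

noncomputable section

/-- `s = (p+q)δ` in the DMPA limit map. -/
def dmpaS (p q δ : ℝ) : ℝ := (p + q) * δ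

/-- `T = 1 + s` in the DMPA limit map. -/
def dmpaT (p q δ : ℝ) : ℝ := 1 + dmpaS p q δ

/-- `A_in = θ_in + r s`. -/
def dmpaAin (r p q δ θin : ℝ) : ℝ := θin + r * dmpaS p q δ

/-- `Ā_in = 1 − θ_in + (1−r) s`. -/
def dmpaAbin (r p q δ θin : ℝ) : ℝ := 1 - θin + (1 - r) * dmpaS p q δ

/-- `A_out = θ_out + r s`. -/
def dmpaAout (r p q δ θout : ℝ) : ℝ := θout + r * dmpaS p q δ

/-- `Ā_out = 1 − θ_out + (1−r) s`. -/
def dmpaAbout (r p q δ θout : ℝ) : ℝ := 1 - θout + (1 - r) * dmpaS p q δ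

/-- Denominator `T − Ā_in h_B − A_in (1−h_R)` of `p1RR`. -/
def dmpaDen1RR (r p q hR hB δ θin : ℝ) : ℝ :=
  dmpaT p q δ - dmpaAbin r p q δ θin * hB - dmpaAin r p q δ θin * (1 - hR)

/-- Denominator `T − Ā_in (1−h_B) − A_in h_R` of `p1BR`. -/
def dmpaDen1BR (r p q hR hB δ θin : ℝ) : ℝ :=
  dmpaT p q δ - dmpaAbin r p q δ θin * (1 - hB) - dmpaAin r p q δ θin * hR

/-- Denominator `T − Ā_out h_R − A_out (1−h_R)` of `p2RR`. -/
def dmpaDen2RR (r p q hR δ θout : ℝ) : ℝ :=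
  dmpaT p q δ - dmpaAbout r p q δ θout * hR - dmpaAout r p q δ θout * (1 - hR)

/-- Denominator `T − Ā_out (1−h_B) − A_out h_B` of `p2BR`. -/
def dmpaDen2BR (r p q hB δ θout : ℝ) : ℝ :=
  dmpaT p q δ - dmpaAbout r p q δ θout * (1 - hB) - dmpaAout r p q δ θout * hB

/-- Denominator `D₃` of the event-3 probabilities. -/
def dmpaD3 (r p q hR hB δ θin θout : ℝ) : ℝ :=
  (dmpaT p q δ) ^ 2
    - dmpaAbout r p q δ θout * dmpaAbin r p q δ θin * (1 - hB)
    - dmpaAbout r p q δ θout * dmpaAin r p q δ θin * hR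
    - dmpaAout r p q δ θout * dmpaAbin r p q δ θin * hB
    - dmpaAout r p q δ θout * dmpaAin r p q δ θin * (1 - hR)

/-- `p1RR = A_in h_R / (T − Ā_in h_B − A_in (1−h_R))`. -/
def dmpaP1RR (r p q hR hB δ θin : ℝ) : ℝ :=
  dmpaAin r p q δ θin * hR / dmpaDen1RR r p q hR hB δ θin

/-- `p1BR = A_in (1−h_R) / (T − Ā_in (1−h_B) − A_in h_R)`. -/
def dmpaP1BR (r p q hR hB δ θin : ℝ) : ℝ :=
  dmpaAin r p q δ θin * (1 - hR) / dmpaDen1BR r p q hR hB δ θin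

/-- `p2RR = A_out h_R / (T − Ā_out h_R − A_out (1−h_R))`. -/
def dmpaP2RR (r p q hR δ θout : ℝ) : ℝ :=
  dmpaAout r p q δ θout * hR / dmpaDen2RR r p q hR δ θout

/-- `p2BR = A_out (1−h_B) / (T − Ā_out (1−h_B) − A_out h_B)`. -/
def dmpaP2BR (r p q hB δ θout : ℝ) : ℝ :=
  dmpaAout r p q δ θout * (1 - hB) / dmpaDen2BR r p q hB δ θout

/-- `p3RR = A_out A_in h_R / D₃`. -/
def dmpaP3RR (r p q hR hB δ θin θout : ℝ) : ℝ :=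
  dmpaAout r p q δ θout * dmpaAin r p q δ θin * hR / dmpaD3 r p q hR hB δ θin θout

/-- `p3BR = Ā_out A_in (1−h_R) / D₃`. -/
def dmpaP3BR (r p q hR hB δ θin θout : ℝ) : ℝ :=
  dmpaAbout r p q δ θout * dmpaAin r p q δ θin * (1 - hR) / dmpaD3 r p q hR hB δ θin θout

/-- `p3RB = A_out Ā_in (1−h_B) / D₃`. -/
def dmpaP3RB (r p q hR hB δ θin θout : ℝ) : ℝ :=
  dmpaAout r p q δ θout * dmpaAbin r p q δ θin * (1 - hB) / dmpaD3 r p q hR hB δ θin θout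

/-- The DMPA limit map `F : [0,1]² → ℝ²`,
`F₁(θ) = p (r·p1RR + (1−r)·p1BR) + q r + (1−p−q)(p3RR + p3BR)`,
`F₂(θ) = p r + q (r·p2RR + (1−r)·p2BR) + (1−p−q)(p3RR + p3RB)`. -/
def dmpaF (r p q hR hB δ : ℝ) (θ : ℝ × ℝ) : ℝ × ℝ :=
  (p * (r * dmpaP1RR r p q hR hB δ θ.1 + (1 - r) * dmpaP1BR r p q hR hB δ θ.1)
      + q * r
      + (1 - p - q) * (dmpaP3RR r p q hR hB δ θ.1 θ.2 + dmpaP3BR r p q hR hB δ θ.1 θ.2),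
    p * r
      + q * (r * dmpaP2RR r p q hR δ θ.2 + (1 - r) * dmpaP2BR r p q hB δ θ.2)
      + (1 - p - q) * (dmpaP3RR r p q hR hB δ θ.1 θ.2 + dmpaP3RB r p q hR hB δ θ.1 θ.2))

theorem dmpaT_pos {p q δ : ℝ} (hpq : 0 < p + q) (hδ : 0 < δ) : 0 < dmpaT p q δ := by
  unfold dmpaT dmpaS
  positivity

theorem dmpaDen1RR_neutral (r p q δ θin : ℝ) :
    dmpaDen1RR r p q (1 / 2) (1 / 2) δ θin = dmpaT p q δ / 2 := by
  unfold dmpaDen1RR dmpaAbin dmpaAin dmpaT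
  ring

theorem dmpaDen1BR_neutral (r p q δ θin : ℝ) :
    dmpaDen1BR r p q (1 / 2) (1 / 2) δ θin = dmpaT p q δ / 2 := by
  unfold dmpaDen1BR dmpaAbin dmpaAin dmpaT
  ring

theorem dmpaDen2RR_neutral (r p q δ θout : ℝ) :
    dmpaDen2RR r p q (1 / 2) δ θout = dmpaT p q δ / 2 := by
  unfold dmpaDen2RR dmpaAbout dmpaAout dmpaT
  ring

theorem dmpaDen2BR_neutral (r p q δ θout : ℝ) :
    dmpaDen2BR r p q (1 / 2) δ θout = dmpaT p q δ / 2 := by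
  unfold dmpaDen2BR dmpaAbout dmpaAout dmpaT
  ring

theorem dmpaD3_neutral (r p q δ θin θout : ℝ) :
    dmpaD3 r p q (1 / 2) (1 / 2) δ θin θout = dmpaT p q δ ^ 2 / 2 := by
  unfold dmpaD3 dmpaAbout dmpaAbin dmpaAout dmpaAin dmpaT
  ring

theorem dmpaAin_self (r p q δ : ℝ) : dmpaAin r p q δ r = r * dmpaT p q δ := by
  unfold dmpaAin dmpaT
  ring

theorem dmpaAbin_self (r p q δ : ℝ) : dmpaAbin r p q δ r = (1 - r) * dmpaT p q δ := by
  unfold dmpaAbin dmpaT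
  ring

theorem dmpaAout_self (r p q δ : ℝ) : dmpaAout r p q δ r = r * dmpaT p q δ := by
  unfold dmpaAout dmpaT
  ring

theorem dmpaAbout_self (r p q δ : ℝ) : dmpaAbout r p q δ r = (1 - r) * dmpaT p q δ := by
  unfold dmpaAbout dmpaT
  ring

theorem dmpaF_neutral_self (r : ℝ) {p q δ : ℝ} (hT : dmpaT p q δ ≠ 0) :
    dmpaF r p q (1 / 2) (1 / 2) δ (r, r) = (r, r) := by
  simp only [dmpaF, dmpaP1RR, dmpaP1BR, dmpaP2RR, dmpaP2BR, dmpaP3RR, dmpaP3BR, dmpaP3RB,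
    dmpaDen1RR_neutral, dmpaDen1BR_neutral, dmpaDen2RR_neutral, dmpaDen2BR_neutral,
    dmpaD3_neutral, dmpaAin_self, dmpaAbin_self, dmpaAout_self, dmpaAbout_self]
  ext <;> field_simp <;> ring

/-- For `r ∈ (0,1)`, `p, q ≥ 0` with `p + q ≤ 1`, `p + q > 0`, any `δ > 0`,
and neutral homophily parameters `h_R = h_B = 1/2`: all denominators of the DMPA limit map are
strictly positive on `[0,1]²`, the point `(r, r)` is a fixed point of `F`, and the asymptotic
power-disparity `θ*_out (1 − θ*_in) / (θ*_in (1 − θ*_out))` evaluated at `θ* = (r, r)`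
equals `1`. -/
theorem dmpa_neutral_homophily_fixed_point_no_disparity
    (r p q δ : ℝ)
    (hr : r ∈ Ioo (0 : ℝ) 1) (hp : 0 ≤ p) (hq : 0 ≤ q)
    (hpq : p + q ≤ 1) (hpq0 : 0 < p + q) (hδ : 0 < δ) :
    (∀ θin ∈ Icc (0 : ℝ) 1, ∀ θout ∈ Icc (0 : ℝ) 1,
      0 < dmpaDen1RR r p q (1 / 2) (1 / 2) δ θin ∧
      0 < dmpaDen1BR r p q (1 / 2) (1 / 2) δ θin ∧
      0 < dmpaDen2RR r p q (1 / 2) δ θout ∧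
      0 < dmpaDen2BR r p q (1 / 2) δ θout ∧
      0 < dmpaD3 r p q (1 / 2) (1 / 2) δ θin θout) ∧
    dmpaF r p q (1 / 2) (1 / 2) δ (r, r) = (r, r) ∧
    r * (1 - r) / (r * (1 - r)) = 1 := by
  have hT := dmpaT_pos hpq0 hδ
  refine ⟨fun θin _ θout _ => ?_, dmpaF_neutral_self r hT.ne', ?_⟩
  · rw [dmpaDen1RR_neutral, dmpaDen1BR_neutral, dmpaDen2RR_neutral, dmpaDen2BR_neutral,
      dmpaD3_neutral]
    have hT2 := half_pos hT
    exact ⟨hT2, hT2, hT2, hT2, half_pos (pow_pos hT 2)⟩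
  · exact div_self (mul_pos hr.1 (sub_pos.2 hr.2)).ne'
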